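/- arXiv:1209.4094 — 2 statements merged into one kernel-verified Lean document; each statement's English description precedes it below -/
import Mathlib

section
/- Let α be a partial action of a group G on a k-algebra A, (μ, β) an enveloping pair of α acting on B, and (μ', Ad') its adjoint pair. Then Ker(μ') = μ⁻¹(Ann(B)), and for every t ∈ G one has μ'(A) ∩ Ad'_t(μ'(A)) = π[ μ(A) ∩ (β_t(μ(A)) + Ann(B)) ]. -/
set_option linter.unusedSectionVars false
set_option linter.unusedVariables false

universe u v w x y

section PartialActionPrelim

variable (k : Type u) [CommRing k] (G : Type v) [Group G] (A : Type w)
  [NonUnitalRing A] [Module k A] [SMulCommClass k A A] [IsScalarTower k A A]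

/-- A partial action of a group `G` on a (not necessarily unital) `k`-algebra `A`:
a family of two-sided ideals `A_t` and algebra isomorphisms `α_t : A_{t⁻¹} → A_t`
(encoded by total functions `act t : A → A` whose behaviour only matters on `A_{t⁻¹}`). -/
structure AlgPartialAction : Type (max u v w) where
  ideal : G → Submodule k A
  act : G → A → A
  mul_mem_left : ∀ (t : G) (a : A), ∀ x ∈ ideal t, a * x ∈ ideal t
  mul_mem_right : ∀ (t : G) (a : A), ∀ x ∈ ideal t, x * a ∈ ideal t
  ideal_one : ideal 1 = ⊤
  act_one : ∀ a : A, act 1 a = a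
  act_mem : ∀ t : G, ∀ a ∈ ideal t⁻¹, act t a ∈ ideal t
  act_add : ∀ t : G, ∀ a ∈ ideal t⁻¹, ∀ b ∈ ideal t⁻¹, act t (a + b) = act t a + act t b
  act_smul : ∀ (t : G) (c : k), ∀ a ∈ ideal t⁻¹, act t (c • a) = c • act t a
  act_mul : ∀ t : G, ∀ a ∈ ideal t⁻¹, ∀ b ∈ ideal t⁻¹, act t (a * b) = act t a * act t b
  act_injOn : ∀ t : G, Set.InjOn (act t) (ideal t⁻¹ : Set A)
  act_image : ∀ s t : G,
    act t '' ((ideal t⁻¹ : Set A) ∩ (ideal s : Set A)) = (ideal t : Set A) ∩ (ideal (t * s) : Set A)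
  act_comp : ∀ s t : G, ∀ a ∈ ideal t⁻¹, act t a ∈ ideal s⁻¹ → act s (act t a) = act (s * t) a

/-- The annihilator `Ann(B) = {b ∈ B : bB = Bb = 0}`. -/
def annih (B : Type x) [NonUnitalRing B] : Set B := {b | ∀ c : B, b * c = 0 ∧ c * b = 0}

variable {k G A}

/-- An enveloping pair `(μ, β)` for a partial action `α`: a global action `β` of `G` on `B`,
an injective algebra homomorphism `μ : A → B` whose range is an ideal, with
`μ(A_t) = μ(A) ∩ β_t(μ(A))`, `β_t ∘ μ = μ ∘ α_t` on `A_{t⁻¹}`, and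
`span {β_t(μ(A)) : t ∈ G} = B`. -/
structure EnvPair (α : AlgPartialAction k G A) (B : Type x) [NonUnitalRing B]
    [Module k B] [SMulCommClass k B B] [IsScalarTower k B B] : Type (max u v w x) where
  β : G → B →ₙₐ[k] B
  β_one : ∀ b : B, β 1 b = b
  β_comp : ∀ (s t : G) (b : B), β (s * t) b = β s (β t b)
  μ : A →ₙₐ[k] B
  μ_inj : Function.Injective μ
  μ_mul_mem_left : ∀ b : B, ∀ x ∈ Set.range μ, b * x ∈ Set.range μ
  μ_mul_mem_right : ∀ b : B, ∀ x ∈ Set.range μ, x * b ∈ Set.range μ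
  inter : ∀ t : G, ⇑μ '' (α.ideal t : Set A) = Set.range μ ∩ (⇑(β t) '' Set.range μ)
  equivar : ∀ t : G, ∀ a ∈ α.ideal t⁻¹, β t (μ a) = μ (α.act t a)
  spans : Submodule.span k (⋃ t : G, ⇑(β t) '' Set.range μ) = ⊤

/-- An isomorphism of enveloping pairs: an algebra isomorphism `φ` intertwining the global
actions with `φ ∘ μ = ν`. -/
def IsEnvPairIso {α : AlgPartialAction k G A} {B : Type x} [NonUnitalRing B]
    [Module k B] [SMulCommClass k B B] [IsScalarTower k B B]
    {C : Type y} [NonUnitalRing C] [Module k C] [SMulCommClass k C C] [IsScalarTower k C C]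
    (P : EnvPair α B) (Q : EnvPair α C) (φ : B → C) : Prop :=
  Function.Bijective φ ∧ (∀ x y : B, φ (x + y) = φ x + φ y) ∧
    (∀ x y : B, φ (x * y) = φ x * φ y) ∧ (∀ (c : k) (x : B), φ (c • x) = c • φ x) ∧
    (∀ (t : G) (b : B), φ (P.β t b) = Q.β t (φ b)) ∧ ∀ a : A, φ (P.μ a) = Q.μ a

/-- An enveloping family of functions for a partial action `α` (Definition 1.7). -/
structure IsEnvFamily (α : AlgPartialAction k G A) (F : G → A → A → A) : Prop where
  mem : ∀ (t : G) (a b : A), F t a b ∈ α.ideal t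
  add_left : ∀ (t : G) (a a' b : A), F t (a + a') b = F t a b + F t a' b
  add_right : ∀ (t : G) (a b b' : A), F t a (b + b') = F t a b + F t a b'
  smul_left : ∀ (t : G) (c : k) (a b : A), F t (c • a) b = c • F t a b
  smul_right : ∀ (t : G) (c : k) (a b : A), F t a (c • b) = c • F t a b
  F_one : ∀ a b : A, F 1 a b = a * b
  cond2a : ∀ (t : G) (a b c : A), F t a (b * c) = F t a b * c
  cond2b : ∀ (t : G) (a b c : A), α.act t (F t⁻¹ (a * b) c) = a * α.act t (F t⁻¹ b c)
  cond2c : ∀ (t : G) (a b c : A), a * F t b c = α.act t (F t⁻¹ a b) * c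
  cond3a : ∀ (s t : G) (a b c : A), F t (F s a b) c = F (t * s) a (F t b c)
  cond3b : ∀ (s t : G) (a b c : A), F t (α.act s⁻¹ (F s a b)) c = F t a (F (t * s⁻¹) b c)
  cond4 : ∀ a : A, a = 0 ↔ ∀ (t : G) (b : A), F t a b = 0 ∧ F t b a = 0
  cond5a : ∀ (s t : G) (b : A), ∀ a ∈ α.ideal t⁻¹, F (s * t) a b = F s (α.act t a) b
  cond5b : ∀ (s t : G) (b : A), ∀ a ∈ α.ideal t⁻¹,
    α.act (s * t) (F (t⁻¹ * s⁻¹) b a) = α.act s (F s⁻¹ b (α.act t a))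
  cond6 : ∀ (t : G) (a : A),
    (∃ b : A, ∀ (s : G) (c : A), F s a c = F (s * t) b c ∧ F s c a = α.act t (F (t⁻¹ * s) c b)) →
    a ∈ α.ideal t

end PartialActionPrelim

section MultiplierPrelim

variable (k : Type u) [CommRing k] (M : Type x) [NonUnitalRing M]
  [Module k M] [SMulCommClass k M M] [IsScalarTower k M M]

/-- A multiplier of a non-unital algebra `M`: a pair `(L, R)` of linear maps with
`L(fg) = L(f)g`, `R(fg) = fR(g)` and `fL(g) = R(f)g`. -/
structure Multiplier : Type (max u x) where
  L : M →ₗ[k] M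
  R : M →ₗ[k] M
  L_mul : ∀ f g : M, L (f * g) = L f * g
  R_mul : ∀ f g : M, R (f * g) = f * R g
  cross : ∀ f g : M, f * L g = R f * g

namespace Multiplier

variable {k M}

@[ext] lemma ext {m n : Multiplier k M} (hL : m.L = n.L) (hR : m.R = n.R) : m = n := by
  cases m; cases n; simp_all

instance : Zero (Multiplier k M) :=
  ⟨⟨0, 0, by simp, by simp, by simp⟩⟩

instance : Add (Multiplier k M) :=
  ⟨fun m n =>
    ⟨m.L + n.L, m.R + n.R,
      by intro f g; simp [m.L_mul, n.L_mul, add_mul],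
      by intro f g; simp [m.R_mul, n.R_mul, mul_add],
      by intro f g; simp [m.cross, n.cross, mul_add, add_mul]⟩⟩

instance : Neg (Multiplier k M) :=
  ⟨fun m =>
    ⟨-m.L, -m.R,
      by intro f g; simp [m.L_mul, neg_mul],
      by intro f g; simp [m.R_mul, mul_neg],
      by intro f g; simp [m.cross, mul_neg, neg_mul]⟩⟩

instance : SMul k (Multiplier k M) :=
  ⟨fun c m =>
    ⟨c • m.L, c • m.R,
      by intro f g; simp [m.L_mul, smul_mul_assoc],
      by intro f g; simp [m.R_mul, mul_smul_comm],
      by intro f g; simp [m.cross, mul_smul_comm, smul_mul_assoc]⟩⟩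

instance : Mul (Multiplier k M) :=
  ⟨fun m n =>
    ⟨m.L ∘ₗ n.L, n.R ∘ₗ m.R,
      by intro f g; simp [n.L_mul, m.L_mul],
      by intro f g; simp [m.R_mul, n.R_mul],
      by intro f g; simp [m.cross, n.cross]⟩⟩

@[simp] lemma zero_L : (0 : Multiplier k M).L = 0 := rfl
@[simp] lemma zero_R : (0 : Multiplier k M).R = 0 := rfl
@[simp] lemma add_L (m n : Multiplier k M) : (m + n).L = m.L + n.L := rfl
@[simp] lemma add_R (m n : Multiplier k M) : (m + n).R = m.R + n.R := rfl
@[simp] lemma neg_L (m : Multiplier k M) : (-m).L = -m.L := rfl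
@[simp] lemma neg_R (m : Multiplier k M) : (-m).R = -m.R := rfl
@[simp] lemma smul_L (c : k) (m : Multiplier k M) : (c • m).L = c • m.L := rfl
@[simp] lemma smul_R (c : k) (m : Multiplier k M) : (c • m).R = c • m.R := rfl
@[simp] lemma mul_L (m n : Multiplier k M) : (m * n).L = m.L ∘ₗ n.L := rfl
@[simp] lemma mul_R (m n : Multiplier k M) : (m * n).R = n.R ∘ₗ m.R := rfl

instance : AddCommGroup (Multiplier k M) where
  add_assoc a b c := by ext <;> simp [add_assoc]
  zero_add a := by ext <;> simp
  add_zero a := by ext <;> simp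
  add_comm a b := by ext <;> simp [add_comm]
  neg_add_cancel a := by ext <;> simp
  nsmul := nsmulRec
  zsmul := zsmulRec

instance : Module k (Multiplier k M) where
  one_smul m := by ext <;> simp
  mul_smul c d m := by ext <;> simp [mul_smul]
  smul_zero c := by ext <;> simp
  smul_add c m n := by ext <;> simp
  add_smul c d m := by ext <;> simp [add_smul]
  zero_smul m := by ext <;> simp

end Multiplier

end MultiplierPrelim

section AdPrelim

variable (k : Type u) [CommRing k] (G : Type v) [Group G] (A : Type w)
  [NonUnitalRing A] [Module k A] [SMulCommClass k A A] [IsScalarTower k A A]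

/-- The left-translation representation `λ_s f (r) = f (s⁻¹ r)` of `G` on `F(G,A)`. -/
def lamRep (s : G) : (G → A) →ₗ[k] (G → A) where
  toFun f := fun r => f (s⁻¹ * r)
  map_add' f g := rfl
  map_smul' c f := rfl

@[simp] lemma lamRep_apply (s : G) (f : G → A) (r : G) : lamRep k G A s f r = f (s⁻¹ * r) := rfl

/-- The global action `Ad` of `G` on the multiplier algebra `M(F(G,A))`. -/
def AdAct (s : G) (m : Multiplier k (G → A)) : Multiplier k (G → A) where
  L := lamRep k G A s ∘ₗ m.L ∘ₗ lamRep k G A s⁻¹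
  R := lamRep k G A s ∘ₗ m.R ∘ₗ lamRep k G A s⁻¹
  L_mul f g := by
    have h : lamRep k G A s⁻¹ (f * g) = lamRep k G A s⁻¹ f * lamRep k G A s⁻¹ g := rfl
    funext r
    simp only [LinearMap.comp_apply, h, m.L_mul, lamRep_apply, Pi.mul_apply]
    simp
  R_mul f g := by
    have h : lamRep k G A s⁻¹ (f * g) = lamRep k G A s⁻¹ f * lamRep k G A s⁻¹ g := rfl
    funext r
    simp only [LinearMap.comp_apply, h, m.R_mul, lamRep_apply, Pi.mul_apply]
    simp
  cross f g := by
    have h := m.cross (lamRep k G A s⁻¹ f) (lamRep k G A s⁻¹ g)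
    funext r
    have h' := congrFun h (s⁻¹ * r)
    simp only [Pi.mul_apply, lamRep_apply, LinearMap.comp_apply] at h' ⊢
    simpa using h'

@[simp] lemma AdAct_L (s : G) (m : Multiplier k (G → A)) :
    (AdAct k G A s m).L = lamRep k G A s ∘ₗ m.L ∘ₗ lamRep k G A s⁻¹ := rfl
@[simp] lemma AdAct_R (s : G) (m : Multiplier k (G → A)) :
    (AdAct k G A s m).R = lamRep k G A s ∘ₗ m.R ∘ₗ lamRep k G A s⁻¹ := rfl

end AdPrelim

section AdjointPair

variable {k : Type u} [CommRing k] {G : Type v} [Group G] {A : Type w}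
  [NonUnitalRing A] [Module k A] [SMulCommClass k A A] [IsScalarTower k A A]
  {α : AlgPartialAction k G A}
  {B : Type x} [NonUnitalRing B] [Module k B] [SMulCommClass k B B] [IsScalarTower k B B]

namespace EnvPair

lemma β_apply_inv (P : EnvPair α B) (t : G) (b : B) : P.β t (P.β t⁻¹ b) = b := by
  rw [← P.β_comp, mul_inv_cancel, P.β_one]

lemma β_inv_apply (P : EnvPair α B) (t : G) (b : B) : P.β t⁻¹ (P.β t b) = b := by
  rw [← P.β_comp, inv_mul_cancel, P.β_one]

/-- Since the translates of `μ(A)` span `B`, the annihilator can be tested against `μ(A)`. -/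
lemma mem_annih_iff (P : EnvPair α B) (d : B) :
    d ∈ annih B ↔ ∀ (r : G) (a : A), P.β r⁻¹ d * P.μ a = 0 ∧ P.μ a * P.β r⁻¹ d = 0 := by
  constructor
  · intro h r a
    rw [← P.β_inv_apply r (P.μ a), ← map_mul, ← map_mul, (h _).1, (h _).2, map_zero]
    exact ⟨rfl, rfl⟩
  · intro h c
    have hc : c ∈ Submodule.span k (⋃ t : G, ⇑(P.β t) '' Set.range P.μ) := by
      rw [P.spans]
      trivial
    induction hc using Submodule.span_induction with
    | mem y hy =>
      obtain ⟨r, _, ⟨a, rfl⟩, rfl⟩ := Set.mem_iUnion.1 hy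
      rw [← P.β_apply_inv r d, ← map_mul, ← map_mul, (h r a).1, (h r a).2, map_zero]
      exact ⟨rfl, rfl⟩
    | zero => simp
    | add y z _ _ hy hz => simp [mul_add, add_mul, hy.1, hy.2, hz.1, hz.2]
    | smul c y _ hy => simp [mul_smul_comm, smul_mul_assoc, hy.1, hy.2]

/-- The defining property of the canonical map `π : B → M(F(G,A))` of an enveloping pair. -/
def IsAdjointMap (P : EnvPair α B) (π : B → Multiplier k (G → A)) : Prop :=
  ∀ (b : B) (f : G → A) (r : G),
    P.μ ((π b).L f r) = P.β r⁻¹ b * P.μ (f r) ∧ P.μ ((π b).R f r) = P.μ (f r) * P.β r⁻¹ b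

namespace IsAdjointMap

variable {P : EnvPair α B} {π : B → Multiplier k (G → A)}

lemma eq_iff (hπ : P.IsAdjointMap π) (b c : B) : π b = π c ↔ b - c ∈ annih B := by
  simp only [P.mem_annih_iff, map_sub, sub_mul, mul_sub, sub_eq_zero]
  constructor
  · intro h r a
    rw [← (hπ b (fun _ => a) r).1, ← (hπ b (fun _ => a) r).2, h]
    exact hπ c (fun _ => a) r
  · intro h
    refine Multiplier.ext ?_ ?_ <;> refine LinearMap.ext fun f => funext fun r => P.μ_inj ?_
    · rw [(hπ b f r).1, (hπ c f r).1, (h r (f r)).1]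
    · rw [(hπ b f r).2, (hπ c f r).2, (h r (f r)).2]

lemma map_zero (hπ : P.IsAdjointMap π) : π 0 = 0 := by
  refine Multiplier.ext ?_ ?_ <;> refine LinearMap.ext fun f => funext fun r => P.μ_inj ?_
  · simp [(hπ 0 f r).1]
  · simp [(hπ 0 f r).2]

lemma eq_zero_iff (hπ : P.IsAdjointMap π) (b : B) : π b = 0 ↔ b ∈ annih B := by
  rw [← hπ.map_zero, hπ.eq_iff, sub_zero]

lemma AdAct_apply (hπ : P.IsAdjointMap π) (t : G) (b : B) :
    AdAct k G A t (π b) = π (P.β t b) := by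
  refine Multiplier.ext ?_ ?_ <;> refine LinearMap.ext fun f => funext fun r => P.μ_inj ?_
  · simp [(hπ _ _ _).1, ← P.β_comp]
  · simp [(hπ _ _ _).2, ← P.β_comp]

end IsAdjointMap

end EnvPair

end AdjointPair

/-- For an enveloping pair `(μ, β)` of `α` acting on `B`, with adjoint pair
`(μ', Ad')` where `μ' = π ∘ μ`: `Ker(μ') = μ⁻¹(Ann(B))`, and for every `t ∈ G`,
`μ'(A) ∩ Ad'_t(μ'(A)) = π[μ(A) ∩ (β_t(μ(A)) + Ann(B))]`. -/
theorem adjoint_inclusion_kernel_and_intersection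
    {k : Type u} [CommRing k] {G : Type v} [Group G] {A : Type w}
    [NonUnitalRing A] [Module k A] [SMulCommClass k A A] [IsScalarTower k A A]
    (α : AlgPartialAction k G A)
    {B : Type x} [NonUnitalRing B] [Module k B] [SMulCommClass k B B] [IsScalarTower k B B]
    (P : EnvPair α B) (π : B → Multiplier k (G → A))
    (hπ : ∀ (b : B) (f : G → A) (r : G),
      P.μ ((π b).L f r) = P.β r⁻¹ b * P.μ (f r) ∧
      P.μ ((π b).R f r) = P.μ (f r) * P.β r⁻¹ b) :
    {a : A | π (P.μ a) = 0} = ⇑P.μ ⁻¹' annih B ∧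
    ∀ t : G,
      Set.range (fun a : A => π (P.μ a)) ∩
          (AdAct k G A t '' Set.range (fun a : A => π (P.μ a))) =
        π '' (Set.range P.μ ∩
          {x : B | ∃ a : A, ∃ n ∈ annih B, x = P.β t (P.μ a) + n}) := by
  have hadj : P.IsAdjointMap π := hπ
  refine ⟨Set.ext fun a => hadj.eq_zero_iff (P.μ a), fun t => Set.ext fun m => ?_⟩
  constructor
  · rintro ⟨⟨a, rfl⟩, _, ⟨c, rfl⟩, h⟩
    refine ⟨P.μ a, ⟨⟨a, rfl⟩, c, P.μ a - P.β t (P.μ c), ?_, by abel⟩, rfl⟩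
    rw [← hadj.eq_iff, ← hadj.AdAct_apply]
    exact h.symm
  · rintro ⟨_, ⟨⟨a, rfl⟩, c, n, hn, h⟩, rfl⟩
    refine ⟨⟨a, rfl⟩, π (P.μ c), ⟨c, rfl⟩, ?_⟩
    rw [hadj.AdAct_apply, eq_comm, hadj.eq_iff, h, add_sub_cancel_left]
    exact hn
end

section
/- Let α be a partial action of a group G on a k-algebra A. Two enveloping pairs of α with trivial annihilator are isomorphic if and only if their adjoint inclusions are equal, in which case their adjoint pairs agree. -/
set_option linter.unusedSectionVars false
set_option linter.unusedVariables false

universe u v w x y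

namespace EnvPair

variable {k : Type u} [CommRing k] {G : Type v} [Group G] {A : Type w}
  [NonUnitalRing A] [Module k A] [SMulCommClass k A A] [IsScalarTower k A A]
  {α : AlgPartialAction k G A}
  {B : Type x} [NonUnitalRing B] [Module k B] [SMulCommClass k B B] [IsScalarTower k B B]
  {C : Type y} [NonUnitalRing C] [Module k C] [SMulCommClass k C C] [IsScalarTower k C C]
  {P : EnvPair α B} {Q : EnvPair α C}
  {π : B → Multiplier k (G → A)} {ρ : C → Multiplier k (G → A)}

/-- `π` is the adjoint representation of the enveloping algebra `B` by multipliers of `F(G,A)`. -/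
def IsAdjointRep (P : EnvPair α B) (π : B → Multiplier k (G → A)) : Prop :=
  ∀ (b : B) (f : G → A) (r : G),
    P.μ ((π b).L f r) = P.β r⁻¹ b * P.μ (f r) ∧ P.μ ((π b).R f r) = P.μ (f r) * P.β r⁻¹ b

lemma multiplier_ext (P : EnvPair α B) {m n : Multiplier k (G → A)}
    (h : ∀ f r, P.μ (m.L f r) = P.μ (n.L f r) ∧ P.μ (m.R f r) = P.μ (n.R f r)) : m = n :=
  Multiplier.ext (LinearMap.ext fun f => funext fun r => P.μ_inj (h f r).1)
    (LinearMap.ext fun f => funext fun r => P.μ_inj (h f r).2)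

namespace IsAdjointRep

lemma map_add (hπ : P.IsAdjointRep π) (b c : B) : π (b + c) = π b + π c :=
  P.multiplier_ext fun f r => by
    simp [(hπ _ f r).1, (hπ _ f r).2, add_mul, mul_add]

lemma map_smul (hπ : P.IsAdjointRep π) (c : k) (b : B) : π (c • b) = c • π b :=
  P.multiplier_ext fun f r => by
    simp [(hπ _ f r).1, (hπ _ f r).2, smul_mul_assoc, mul_smul_comm]

lemma map_mul (hπ : P.IsAdjointRep π) (b c : B) : π (b * c) = π b * π c :=
  P.multiplier_ext fun f r => by
    simp [(hπ _ _ r).1, (hπ _ _ r).2, mul_assoc]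

lemma map_β (hπ : P.IsAdjointRep π) (t : G) (b : B) : π (P.β t b) = AdAct k G A t (π b) :=
  P.multiplier_ext fun f r => by
    simp [(hπ _ _ _).1, (hπ _ _ _).2, P.β_comp]

lemma map_zero (hπ : P.IsAdjointRep π) : π 0 = 0 := by
  have h := hπ.map_add 0 0
  rwa [add_zero, left_eq_add] at h

lemma map_sub (hπ : P.IsAdjointRep π) (b c : B) : π (b - c) = π b - π c := by
  rw [eq_sub_iff_add_eq, ← hπ.map_add, sub_add_cancel]

lemma mem_annih_of_map_eq_zero (hπ : P.IsAdjointRep π) {b : B} (hb : π b = 0) : b ∈ annih B := by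
  have key (r : G) (a : A) : b * P.β r (P.μ a) = 0 ∧ P.β r (P.μ a) * b = 0 := by
    have h := hπ b (fun _ => a) r
    have hr : P.β r (P.β r⁻¹ b) = b := by rw [← P.β_comp, mul_inv_cancel, P.β_one]
    simp only [hb, Multiplier.zero_L, Multiplier.zero_R, LinearMap.zero_apply, Pi.zero_apply,
      _root_.map_zero] at h
    constructor
    · simpa [hr] using (congrArg (P.β r) h.1).symm
    · simpa [hr] using (congrArg (P.β r) h.2).symm
  intro c
  have hc : c ∈ Submodule.span k (⋃ t : G, ⇑(P.β t) '' Set.range P.μ) := by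
    rw [P.spans]; trivial
  induction hc using Submodule.span_induction with
  | mem c hc =>
    obtain ⟨t, _, ⟨a, rfl⟩, rfl⟩ := Set.mem_iUnion.mp hc
    exact key t a
  | zero => simp
  | add c d _ _ hc hd => simp [mul_add, add_mul, hc.1, hc.2, hd.1, hd.2]
  | smul s c _ hc => simp [mul_smul_comm, smul_mul_assoc, hc.1, hc.2]

lemma injective (hπ : P.IsAdjointRep π) (hAnn : annih B = {0}) : Function.Injective π := by
  intro b c h
  have h0 : b - c ∈ annih B := hπ.mem_annih_of_map_eq_zero (by rw [hπ.map_sub, h, sub_self])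
  rw [hAnn] at h0
  exact sub_eq_zero.mp h0

lemma exists_map_eq (hπ : P.IsAdjointRep π) (hρ : Q.IsAdjointRep ρ)
    (h : ∀ a : A, π (P.μ a) = ρ (Q.μ a)) (b : B) : ∃ c : C, ρ c = π b := by
  have hb : b ∈ Submodule.span k (⋃ t : G, ⇑(P.β t) '' Set.range P.μ) := by
    rw [P.spans]; trivial
  induction hb using Submodule.span_induction with
  | mem b hb =>
    obtain ⟨t, _, ⟨a, rfl⟩, rfl⟩ := Set.mem_iUnion.mp hb
    exact ⟨Q.β t (Q.μ a), by rw [hρ.map_β, hπ.map_β, h]⟩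
  | zero => exact ⟨0, by rw [hρ.map_zero, hπ.map_zero]⟩
  | add b d _ _ hb hd =>
    obtain ⟨c, hc⟩ := hb
    obtain ⟨e, he⟩ := hd
    exact ⟨c + e, by rw [hρ.map_add, hπ.map_add, hc, he]⟩
  | smul s b _ hb =>
    obtain ⟨c, hc⟩ := hb
    exact ⟨s • c, by rw [hρ.map_smul, hπ.map_smul, hc]⟩

lemma range_eq (hπ : P.IsAdjointRep π) (hρ : Q.IsAdjointRep ρ)
    (h : ∀ a : A, π (P.μ a) = ρ (Q.μ a)) : Set.range π = Set.range ρ :=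
  Set.Subset.antisymm (Set.range_subset_iff.mpr (hπ.exists_map_eq hρ h))
    (Set.range_subset_iff.mpr (hρ.exists_map_eq hπ fun a => (h a).symm))

lemma map_iso (hπ : P.IsAdjointRep π) (hρ : Q.IsAdjointRep ρ) {φ : B → C}
    (hφ : IsEnvPairIso P Q φ) (b : B) : π b = ρ (φ b) := by
  obtain ⟨-, -, hmul, -, hβ, hμ⟩ := hφ
  refine Q.multiplier_ext fun f r => ⟨?_, ?_⟩
  · rw [(hρ _ f r).1, ← hμ, (hπ b f r).1, hmul, hβ, hμ]
  · rw [(hρ _ f r).2, ← hμ, (hπ b f r).2, hmul, hβ, hμ]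

lemma exists_iso (hπ : P.IsAdjointRep π) (hρ : Q.IsAdjointRep ρ)
    (hAnnB : annih B = {0}) (hAnnC : annih C = {0})
    (h : ∀ a : A, π (P.μ a) = ρ (Q.μ a)) : ∃ φ : B → C, IsEnvPairIso P Q φ := by
  have hπi := hπ.injective hAnnB
  have hρi := hρ.injective hAnnC
  choose φ hφ using hπ.exists_map_eq hρ h
  refine ⟨φ, ⟨fun b c hbc => hπi ?_, fun c => ?_⟩, fun b c => hρi ?_, fun b c => hρi ?_,
    fun s b => hρi ?_, fun t b => hρi ?_, fun a => hρi ?_⟩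
  · rw [← hφ, ← hφ, hbc]
  · obtain ⟨b, hb⟩ := hρ.exists_map_eq hπ (fun a => (h a).symm) c
    exact ⟨b, hρi (by rw [hφ, hb])⟩
  · rw [hφ, hρ.map_add, hφ, hφ, hπ.map_add]
  · rw [hφ, hρ.map_mul, hφ, hφ, hπ.map_mul]
  · rw [hφ, hρ.map_smul, hφ, hπ.map_smul]
  · rw [hφ, hρ.map_β, hφ, hπ.map_β]
  · rw [hφ, h]

end IsAdjointRep

end EnvPair

/-- **Theorem 1.6.** Two enveloping pairs of `α` with trivial annihilator are
isomorphic if and only if their adjoint inclusions `μ' = π ∘ μ` are equal, in which case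
their adjoint pairs agree (in particular `π_B(B) = π_C(C)`). -/
theorem envPairs_iso_iff_adjoint_inclusions_eq
    {k : Type u} [CommRing k] {G : Type v} [Group G] {A : Type w}
    [NonUnitalRing A] [Module k A] [SMulCommClass k A A] [IsScalarTower k A A]
    (α : AlgPartialAction k G A)
    {B : Type x} [NonUnitalRing B] [Module k B] [SMulCommClass k B B] [IsScalarTower k B B]
    {C : Type y} [NonUnitalRing C] [Module k C] [SMulCommClass k C C] [IsScalarTower k C C]
    (P : EnvPair α B) (Q : EnvPair α C)
    (hAnnB : annih B = {0}) (hAnnC : annih C = {0})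
    (πB : B → Multiplier k (G → A)) (πC : C → Multiplier k (G → A))
    (hπB : ∀ (b : B) (f : G → A) (r : G),
      P.μ ((πB b).L f r) = P.β r⁻¹ b * P.μ (f r) ∧
      P.μ ((πB b).R f r) = P.μ (f r) * P.β r⁻¹ b)
    (hπC : ∀ (c : C) (f : G → A) (r : G),
      Q.μ ((πC c).L f r) = Q.β r⁻¹ c * Q.μ (f r) ∧
      Q.μ ((πC c).R f r) = Q.μ (f r) * Q.β r⁻¹ c) :
    ((∃ φ : B → C, IsEnvPairIso P Q φ) ↔ (∀ a : A, πB (P.μ a) = πC (Q.μ a))) ∧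
    ((∀ a : A, πB (P.μ a) = πC (Q.μ a)) → Set.range πB = Set.range πC) := by
  have hB : P.IsAdjointRep πB := hπB
  have hC : Q.IsAdjointRep πC := hπC
  refine ⟨⟨?_, hB.exists_iso hC hAnnB hAnnC⟩, hB.range_eq hC⟩
  rintro ⟨φ, hφ⟩ a
  rw [hB.map_iso hC hφ, hφ.2.2.2.2.2]
end
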